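/- arXiv:1611.01600 — 4 statements merged into one kernel-verified Lean document; each statement's English description precedes it below -/
import Mathlib

section
/- (Proposition 1, single layer.) Let n ≥ 1, let d ∈ ℝⁿ with dᵢ > 0 for all i, let u, g ∈ ℝⁿ, and define f(x) = ⟨g, x − u⟩ + (1/2)·∑ᵢ dᵢ (xᵢ − uᵢ)². Define w ∈ ℝⁿ by wᵢ = uᵢ − gᵢ/dᵢ, set α* = (∑ᵢ dᵢ|wᵢ|) / (∑ᵢ dᵢ) and b* = sign(w), and assume α* > 0. Then for every α > 0 and every b ∈ ℝⁿ with bᵢ ∈ {−1, 1} for all i, f(α*·b*) ≤ f(α·b); that is, x = α*·sign(w) minimizes the quadratic model f over the set {α b : α > 0, b ∈ {−1,+1}ⁿ}. -/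
/-- Proposition 1 (single layer): `x = α*·sign(w)`, with
`wᵢ = uᵢ − gᵢ/dᵢ` and `α* = (∑ᵢ dᵢ|wᵢ|)/(∑ᵢ dᵢ)`, minimizes the quadratic model
`f(x) = ⟨g, x − u⟩ + (1/2)·∑ᵢ dᵢ (xᵢ − uᵢ)²` over `{α b : α > 0, b ∈ {−1,+1}ⁿ}`. -/
theorem stmt_4 (n : ℕ) (hn : 1 ≤ n) (d u g : Fin n → ℝ) (hd : ∀ i, 0 < d i)
    (w : Fin n → ℝ) (hw : ∀ i, w i = u i - g i / d i)
    (αs : ℝ) (hαs : αs = (∑ i, d i * |w i|) / (∑ i, d i)) (hαspos : 0 < αs)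
    (α : ℝ) (hα : 0 < α) (b : Fin n → ℝ) (hb : ∀ i, b i = -1 ∨ b i = 1) :
    (∑ i, g i * (αs * (if 0 ≤ w i then (1 : ℝ) else -1) - u i)) +
        (1 / 2) * ∑ i, d i * (αs * (if 0 ≤ w i then (1 : ℝ) else -1) - u i) ^ 2 ≤
      (∑ i, g i * (α * b i - u i)) + (1 / 2) * ∑ i, d i * (α * b i - u i) ^ 2 := by
  have hD : 0 < ∑ i, d i :=
    Finset.sum_pos (fun i _ => hd i) ⟨⟨0, hn⟩, Finset.mem_univ _⟩
  have hS : ∑ i, d i * |w i| = αs * ∑ i, d i := by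
    rw [hαs]; field_simp
  have hg : ∀ i, g i = d i * (u i - w i) := by
    intro i
    have := (hd i).ne'
    rw [hw i]; field_simp; ring
  have key : ∀ i, (g i * (αs * (if 0 ≤ w i then (1 : ℝ) else -1) - u i)
      + (1 / 2) * (d i * (αs * (if 0 ≤ w i then (1 : ℝ) else -1) - u i) ^ 2))
      + ((α ^ 2 - αs ^ 2) / 2 * d i - (α - αs) * (d i * |w i|))
      ≤ g i * (α * b i - u i) + (1 / 2) * (d i * (α * b i - u i) ^ 2) := by
    intro i
    rw [hg i]
    have hda : 0 < d i * α := mul_pos (hd i) hα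
    by_cases h : 0 ≤ w i
    · have h1 := mul_nonneg hda.le h
      rw [if_pos h, abs_of_nonneg h]
      rcases hb i with h' | h' <;> rw [h'] <;> nlinarith
    · have h0 : w i < 0 := not_le.mp h
      have h1 := mul_nonneg hda.le (neg_nonneg.mpr h0.le)
      rw [if_neg h, abs_of_neg h0]
      rcases hb i with h' | h' <;> rw [h'] <;> nlinarith
  have hs := Finset.sum_le_sum (fun i (_ : i ∈ Finset.univ) => key i)
  simp only [Finset.sum_add_distrib, Finset.sum_sub_distrib, ← Finset.mul_sum] at hs
  rw [hS] at hs
  nlinarith [mul_nonneg hD.le (sq_nonneg (α - αs))]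
end

section
/- (Proposition 1, multi-layer.) Let L ≥ 1 and let n : Fin L → ℕ give the layer sizes. For each layer l, let d_l ∈ ℝ^{n_l} with all entries positive, let u_l, g_l ∈ ℝ^{n_l}, and define the total quadratic model F(x₁,…,x_L) = ∑_l [⟨g_l, x_l − u_l⟩ + (1/2)·∑ᵢ (d_l)ᵢ ((x_l)ᵢ − (u_l)ᵢ)²]. Define w_l by (w_l)ᵢ = (u_l)ᵢ − (g_l)ᵢ/(d_l)ᵢ, set α*_l = (∑ᵢ (d_l)ᵢ|(w_l)ᵢ|)/(∑ᵢ (d_l)ᵢ) and b*_l = sign(w_l), and assume α*_l > 0 for every l. Then for every choice of scalars α_l > 0 and vectors b_l with entries in {−1,1}, F(α*_1 b*_1, …, α*_L b*_L) ≤ F(α_1 b_1, …, α_L b_L). -/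
/-- Proposition 1 (multi-layer): with `(w_l)ᵢ = (u_l)ᵢ − (g_l)ᵢ/(d_l)ᵢ`,
`α*_l = (∑ᵢ (d_l)ᵢ|(w_l)ᵢ|)/(∑ᵢ (d_l)ᵢ) > 0` and `b*_l = sign(w_l)`, the tuple
`(α*_1 b*_1, …, α*_L b*_L)` minimizes the total quadratic model
`F(x₁,…,x_L) = ∑_l [⟨g_l, x_l − u_l⟩ + (1/2)·∑ᵢ (d_l)ᵢ ((x_l)ᵢ − (u_l)ᵢ)²]`
over all tuples `(α_1 b_1, …, α_L b_L)` with `α_l > 0` and `b_l ∈ {−1,+1}^{n_l}`. -/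
theorem stmt_5 (L : ℕ) (hL : 1 ≤ L) (n : Fin L → ℕ)
    (d u g : ∀ l, Fin (n l) → ℝ) (hd : ∀ l i, 0 < d l i)
    (w : ∀ l, Fin (n l) → ℝ) (hw : ∀ l i, w l i = u l i - g l i / d l i)
    (αs : Fin L → ℝ) (hαs : ∀ l, αs l = (∑ i, d l i * |w l i|) / (∑ i, d l i))
    (hαspos : ∀ l, 0 < αs l)
    (α : Fin L → ℝ) (hα : ∀ l, 0 < α l)
    (b : ∀ l, Fin (n l) → ℝ) (hb : ∀ l i, b l i = -1 ∨ b l i = 1) :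
    ∑ l, ((∑ i, g l i * (αs l * (if 0 ≤ w l i then (1 : ℝ) else -1) - u l i)) +
        (1 / 2) * ∑ i, d l i * (αs l * (if 0 ≤ w l i then (1 : ℝ) else -1) - u l i) ^ 2) ≤
      ∑ l, ((∑ i, g l i * (α l * b l i - u l i)) +
        (1 / 2) * ∑ i, d l i * (α l * b l i - u l i) ^ 2) := by
  apply Finset.sum_le_sum
  intro l _
  have hS : (∑ i, d l i) ≠ 0 := by
    intro h
    have h1 := hαspos l
    rw [hαs l, h, div_zero] at h1
    exact lt_irrefl _ h1
  have hT : ∑ i, d l i * |w l i| = αs l * ∑ i, d l i := by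
    rw [hαs l, div_mul_cancel₀ _ hS]
  have hSn : 0 ≤ ∑ i, d l i := Finset.sum_nonneg fun i _ => (hd l i).le
  rw [Finset.mul_sum, Finset.mul_sum, ← Finset.sum_add_distrib, ← Finset.sum_add_distrib]
  have key : ∑ i, ((1 / 2 * (α l ^ 2 - αs l ^ 2)) * d l i - (α l - αs l) * (d l i * |w l i|)) ≤
      ∑ i, ((g l i * (α l * b l i - u l i) + 1 / 2 * (d l i * (α l * b l i - u l i) ^ 2)) -
        (g l i * (αs l * (if 0 ≤ w l i then (1 : ℝ) else -1) - u l i) +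
          1 / 2 * (d l i * (αs l * (if 0 ≤ w l i then (1 : ℝ) else -1) - u l i) ^ 2))) := by
    apply Finset.sum_le_sum
    intro i _
    have hdi := hd l i
    have hg : g l i = d l i * (u l i - w l i) := by
      rw [hw l i]
      field_simp
      ring
    have hp : 0 ≤ α l * d l i := (mul_pos (hα l) hdi).le
    rw [hg]
    split_ifs with h
    · rw [abs_of_nonneg h]
      rcases hb l i with hbi | hbi <;> rw [hbi] <;> nlinarith [mul_nonneg hp h]
    · have h' : 0 ≤ - w l i := by linarith
      rw [abs_of_neg (not_le.mp h)]
      rcases hb l i with hbi | hbi <;> rw [hbi] <;> nlinarith [mul_nonneg hp h']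
  rw [Finset.sum_sub_distrib, Finset.sum_sub_distrib, ← Finset.mul_sum, ← Finset.mul_sum, hT] at key
  nlinarith [mul_nonneg hSn (sq_nonneg (α l - αs l))]
end

section
/- (Remark 1 / BWN closed form.) Let n ≥ 1 and w ∈ ℝⁿ with w ≠ 0. Set α* = ‖w‖₁/n and b* = sign(w). Then for every α > 0 and every b ∈ ℝⁿ with bᵢ ∈ {−1, 1} for all i, ‖w − α*·b*‖₂² ≤ ‖w − α·b‖₂²; that is, (α*, b*) minimizes the Euclidean approximation error ‖w − α b‖₂² over α > 0 and binary b. -/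
/-- Remark 1 / BWN closed form: `α* = ‖w‖₁/n`, `b* = sign(w)` minimize the
Euclidean approximation error `‖w − α b‖₂²` over `α > 0` and binary `b`. -/
theorem stmt_6 (n : ℕ) (hn : 1 ≤ n) (w : Fin n → ℝ) (hw : w ≠ 0)
    (αs : ℝ) (hαs : αs = (∑ i, |w i|) / n)
    (α : ℝ) (hα : 0 < α) (b : Fin n → ℝ) (hb : ∀ i, b i = -1 ∨ b i = 1) :
    ∑ i, (w i - αs * (if 0 ≤ w i then (1 : ℝ) else -1)) ^ 2 ≤
      ∑ i, (w i - α * b i) ^ 2 := by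
  have hn0 : (n : ℝ) ≠ 0 := by
    have : n ≠ 0 := by omega
    exact_mod_cast this
  have hS : ∑ i, |w i| = n * αs := by
    rw [hαs]; field_simp
  have h0 : ∑ i, (|w i| - αs) = 0 := by
    rw [Finset.sum_sub_distrib, hS]; simp
  have h1 : ∑ i, (w i - αs * (if 0 ≤ w i then (1 : ℝ) else -1)) ^ 2
      = ∑ i, (|w i| - αs) ^ 2 := by
    refine Finset.sum_congr rfl fun i _ => ?_
    split_ifs with h
    · rw [abs_of_nonneg h]; ring
    · rw [abs_of_neg (not_le.mp h)]; ring
  have h2 : ∑ i, ((|w i| - αs) ^ 2 + 2 * (αs - α) * (|w i| - αs))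
      ≤ ∑ i, (w i - α * b i) ^ 2 := by
    refine Finset.sum_le_sum fun i _ => ?_
    have e := sq_abs (w i)
    rcases hb i with h | h <;> rw [h]
    · nlinarith [mul_nonneg hα.le (sub_nonneg.2 (neg_abs_le (w i))), sq_nonneg (αs - α)]
    · nlinarith [mul_nonneg hα.le (sub_nonneg.2 (le_abs_self (w i))), sq_nonneg (αs - α)]
  rw [Finset.sum_add_distrib, ← Finset.mul_sum, h0] at h2
  rw [h1]
  linarith
end

section
/- (Theorem 1.) Let ℓ : ℝⁿ → ℝ be differentiable with β-Lipschitz gradient and bounded from below. Let c > 0, let (ŵᵗ)_{t≥0} be a sequence in ℝⁿ, and let (dᵗ)_{t≥0} be a sequence of vectors in ℝⁿ with (dᵗ)ᵢ ≥ β + c for all i and t. Suppose that for every t ≥ 1, ⟨∇ℓ(ŵ^{t−1}), ŵᵗ − ŵ^{t−1}⟩ + (1/2)·∑ᵢ (d^{t−1})ᵢ (ŵᵗᵢ − ŵ^{t−1}ᵢ)² ≤ 0. Then the sequence of loss values (ℓ(ŵᵗ))_{t≥0} converges (to a finite limit). -/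
open scoped RealInnerProductSpace

theorem descent_aux {n : ℕ} (ℓ : EuclideanSpace ℝ (Fin n) → ℝ) (β : ℝ)
    (hdiff : Differentiable ℝ ℓ)
    (hlip : ∀ u v, ‖gradient ℓ u - gradient ℓ v‖ ≤ β * ‖u - v‖)
    (x v : EuclideanSpace ℝ (Fin n)) :
    ℓ (x + v) ≤ ℓ x + ⟪gradient ℓ x, v⟫ + β / 2 * ‖v‖ ^ 2 := by
  have hf : ∀ s : ℝ, HasDerivAt (fun s : ℝ => ℓ (x + s • v)) ⟪gradient ℓ (x + s • v), v⟫ s := by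
    intro s
    have h1 := (hdiff (x + s • v)).hasGradientAt.hasFDerivAt
    have h2 : HasDerivAt (fun s : ℝ => x + s • v) v s := by
      simpa using ((hasDerivAt_id s).smul_const v).const_add x
    exact (h1.comp_hasDerivAt s h2).congr_deriv (by simp)
  have hB : ∀ s : ℝ, HasDerivAt
      (fun s : ℝ => ℓ x + s * ⟪gradient ℓ x, v⟫ + β / 2 * ‖v‖ ^ 2 * s ^ 2)
      (⟪gradient ℓ x, v⟫ + β * ‖v‖ ^ 2 * s) s := by
    intro s
    have h1 := ((hasDerivAt_id s).mul_const ⟪gradient ℓ x, v⟫).const_add (ℓ x)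
    have h2 := (hasDerivAt_pow 2 s).const_mul (β / 2 * ‖v‖ ^ 2)
    refine (h1.add h2).congr_deriv ?_
    simp
    ring
  have key := image_le_of_deriv_right_le_deriv_boundary (a := 0) (b := 1)
    (fun s _ => (hf s).continuousAt.continuousWithinAt)
    (fun s _ => (hf s).hasDerivWithinAt) (by simp)
    (fun s _ => (hB s).continuousAt.continuousWithinAt)
    (fun s _ => (hB s).hasDerivWithinAt) (by
      intro s hs
      have h1 := real_inner_le_norm (gradient ℓ (x + s • v) - gradient ℓ x) v
      have h2 := hlip (x + s • v) x
      rw [add_sub_cancel_left, norm_smul, Real.norm_of_nonneg hs.1] at h2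
      rw [inner_sub_left] at h1
      nlinarith [mul_le_mul_of_nonneg_right h2 (norm_nonneg v)])
    (Set.right_mem_Icc.2 zero_le_one)
  simpa using key

/-- Theorem 1: if `ℓ` is differentiable with `β`-Lipschitz gradient and bounded below,
and each iterate satisfies the proximal-Newton model-decrease condition with diagonal
Hessian entries `≥ β + c`, then the sequence of loss values converges. -/
theorem stmt_10 (n : ℕ) (ℓ : EuclideanSpace ℝ (Fin n) → ℝ) (β : ℝ)
    (hdiff : Differentiable ℝ ℓ)
    (hlip : ∀ u v, ‖gradient ℓ u - gradient ℓ v‖ ≤ β * ‖u - v‖)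
    (hbdd : ∃ M : ℝ, ∀ x, M ≤ ℓ x)
    (c : ℝ) (hc : 0 < c)
    (w : ℕ → EuclideanSpace ℝ (Fin n)) (d : ℕ → Fin n → ℝ)
    (hd : ∀ t i, β + c ≤ d t i)
    (hmin : ∀ t : ℕ, ⟪gradient ℓ (w t), w (t + 1) - w t⟫ +
      (1 / 2) * ∑ i, d t i * (w (t + 1) i - w t i) ^ 2 ≤ 0) :
    ∃ l : ℝ, Filter.Tendsto (fun t => ℓ (w t)) Filter.atTop (nhds l) := by
  have hdec : Antitone (fun t => ℓ (w t)) := by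
    refine antitone_nat_of_succ_le fun t => ?_
    have h := descent_aux ℓ β hdiff hlip (w t) (w (t + 1) - w t)
    rw [add_sub_cancel] at h
    have h2 : (β + c) * ‖w (t + 1) - w t‖ ^ 2 ≤ ∑ i, d t i * (w (t + 1) i - w t i) ^ 2 := by
      rw [EuclideanSpace.real_norm_sq_eq, Finset.mul_sum]
      exact Finset.sum_le_sum fun i _ => mul_le_mul_of_nonneg_right (hd t i) (sq_nonneg _)
    have h3 := hmin t
    have h4 : 0 ≤ c * ‖w (t + 1) - w t‖ ^ 2 := by positivity
    linarith
  obtain ⟨M, hM⟩ := hbdd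
  exact ⟨_, tendsto_atTop_ciInf hdec ⟨M, by rintro _ ⟨t, rfl⟩; exact hM _⟩⟩
end
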